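/- Let M be a spacelike surface in ℝ^{3,1} with a canonical normal null direction Z. If M is minimal, i.e. H⃗ = 0, then M is flat and has flat normal bundle, i.e. K = 0 and K_N = 0. -/

import Mathlib

noncomputable section

/-- Points of the parameter domain of the surface chart. -/
abbrev Pt : Type := ℝ × ℝ

/-- Vectors of the Minkowski space `ℝ^{3,1}`. -/
abbrev E4 : Type := Fin 4 → ℝ

/-- The Minkowski bilinear form of signature `(+,+,+,-)` on `ℝ⁴`. -/
def mink (v w : E4) : ℝ := v 0 * w 0 + v 1 * w 1 + v 2 * w 2 - v 3 * w 3

/-- Realization in `ℝ^{3,1}` of a coordinate vector field `X` along the immersion `ψ`. -/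
def vecF (ψ : Pt → E4) (X : Pt → Pt) : Pt → E4 := fun p => fderiv ℝ ψ p (X p)

/-- Flat (ambient) derivative of an `ℝ⁴`-valued field along a coordinate vector field. -/
def Dflat (X : Pt → Pt) (V : Pt → E4) : Pt → E4 := fun p => fderiv ℝ V p (X p)

/-- Second fundamental form `B(X,Y) = ∇̄_X Y − ∇_X Y`. -/
def sff (ψ : Pt → E4) (conn : (Pt → Pt) → (Pt → Pt) → Pt → Pt) (X Y : Pt → Pt) : Pt → E4 :=
  fun p => Dflat X (vecF ψ Y) p - vecF ψ (conn X Y) p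

/-- `v` is tangent to the surface at `p`. -/
def isTangentV (ψ : Pt → E4) (p : Pt) (v : E4) : Prop := ∃ w : Pt, fderiv ℝ ψ p w = v

/-- `v` is normal to the surface at `p`. -/
def isNormalV (ψ : Pt → E4) (p : Pt) (v : E4) : Prop := ∀ w : Pt, mink v (fderiv ℝ ψ p w) = 0

/-- Lie bracket of coordinate vector fields on the chart. -/
def lieB (X Y : Pt → Pt) : Pt → Pt := fun p => fderiv ℝ Y p (X p) - fderiv ℝ X p (Y p)

/-- Curvature tensor `R(X,Y)V = ∇_Y∇_X V − ∇_X∇_Y V + ∇_{[X,Y]}V`. -/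
def curvR (conn : (Pt → Pt) → (Pt → Pt) → Pt → Pt) (X Y V : Pt → Pt) : Pt → Pt :=
  fun p => conn Y (conn X V) p - conn X (conn Y V) p + conn (lieB X Y) V p

/-- Normal curvature tensor `R^⊥(X,Y)ν = ∇⊥_Y∇⊥_X ν − ∇⊥_X∇⊥_Y ν + ∇⊥_{[X,Y]}ν`. -/
def curvRperp (nconn : (Pt → Pt) → (Pt → E4) → Pt → E4) (X Y : Pt → Pt) (ν : Pt → E4) :
    Pt → E4 :=
  fun p => nconn Y (nconn X ν) p - nconn X (nconn Y ν) p + nconn (lieB X Y) ν p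

/-- Determinant of four vectors of `ℝ⁴` (the volume form `e₁∧e₂∧e₃∧e₄ ↦ 1`). -/
def det4 (a b c d : E4) : ℝ := Matrix.det (Matrix.of ![a, b, c, d])

/-- A spacelike surface in `ℝ^{3,1}`, given by a chart `ψ : U → ℝ^{3,1}`, endowed with a
canonical normal null direction with respect to the constant unit spacelike vector `Z`,
together with all the associated geometric data: the Levi-Civita connection `conn`,
the normal connection `nconn`, the tangent part `Z^⊤` (coordinates `ZT`), the oriented
orthonormal completion `W` (coordinates `Wc`), the shape operator `shA = A_{Z^⊥}`,
the 1-form `β` with `B(X,Z^⊤) = β(X)Z^⊥`, and the lightlike normal field `W'` with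
`⟨Z^⊥,W'⟩ = 1`.  Each piece of data is characterized by its defining property. -/
structure CNND where
  U : Set Pt
  hUopen : IsOpen U
  ψ : Pt → E4
  hψ : ContDiffOn ℝ (⊤ : ℕ∞) ψ U
  himm : ∀ p ∈ U, ∀ v : Pt, fderiv ℝ ψ p v = 0 → v = 0
  hspacelike : ∀ p ∈ U, ∀ v : Pt, v ≠ 0 → 0 < mink (fderiv ℝ ψ p v) (fderiv ℝ ψ p v)
  /-- Levi-Civita connection of the induced metric, as the tangent part of the flat one. -/
  conn : (Pt → Pt) → (Pt → Pt) → Pt → Pt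
  hconn : ∀ X Y, ∀ p ∈ U, DifferentiableAt ℝ (vecF ψ Y) p → isNormalV ψ p (sff ψ conn X Y p)
  hconnSmooth : ∀ X Y, ContDiffOn ℝ (⊤ : ℕ∞) X U → ContDiffOn ℝ (⊤ : ℕ∞) Y U → ContDiffOn ℝ (⊤ : ℕ∞) (conn X Y) U
  /-- Normal connection: the normal part of the flat derivative of a normal field. -/
  nconn : (Pt → Pt) → (Pt → E4) → Pt → E4
  hnconn : ∀ X ν, ∀ p ∈ U, (∀ q ∈ U, isNormalV ψ q (ν q)) → DifferentiableAt ℝ ν p →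
    isNormalV ψ p (nconn X ν p) ∧ isTangentV ψ p (Dflat X ν p - nconn X ν p)
  hnconnSmooth : ∀ X ν, ContDiffOn ℝ (⊤ : ℕ∞) X U → (∀ q ∈ U, isNormalV ψ q (ν q)) →
    ContDiffOn ℝ (⊤ : ℕ∞) ν U → ContDiffOn ℝ (⊤ : ℕ∞) (nconn X ν) U
  /-- The parallel (constant) vector field `Z`, a unit spacelike vector. -/
  Z : E4
  hZunit : mink Z Z = 1
  /-- Coordinates of the tangent part `Z^⊤` of `Z`; `Z^⊥ = Z − Z^⊤` is normal. -/
  ZT : Pt → Pt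
  hZTsmooth : ContDiffOn ℝ (⊤ : ℕ∞) ZT U
  hZTtangentpart : ∀ p ∈ U, isNormalV ψ p (Z - fderiv ℝ ψ p (ZT p))
  /-- canonical normal null direction: `Z^⊥` is lightlike … -/
  hZperpNull : ∀ p ∈ U, mink (Z - fderiv ℝ ψ p (ZT p)) (Z - fderiv ℝ ψ p (ZT p)) = 0
  /-- … and nowhere zero. -/
  hZperpNe : ∀ p ∈ U, Z - fderiv ℝ ψ p (ZT p) ≠ 0
  /-- Coordinates of the unit tangent field `W` orthogonal to `Z^⊤`, positively oriented. -/
  Wc : Pt → Pt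
  hWsmooth : ContDiffOn ℝ (⊤ : ℕ∞) Wc U
  hWunit : ∀ p ∈ U, mink (fderiv ℝ ψ p (Wc p)) (fderiv ℝ ψ p (Wc p)) = 1
  hWorth : ∀ p ∈ U, mink (fderiv ℝ ψ p (ZT p)) (fderiv ℝ ψ p (Wc p)) = 0
  hWorient : ∀ p ∈ U, 0 < (ZT p).1 * (Wc p).2 - (ZT p).2 * (Wc p).1
  /-- The shape operator `A_{Z^⊥}`: `⟨A_{Z^⊥}X, Y⟩ = ⟨B(X,Y), Z^⊥⟩`. -/
  shA : (Pt → Pt) → Pt → Pt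
  hshA : ∀ X Y, ∀ p ∈ U, DifferentiableAt ℝ (vecF ψ Y) p →
    mink (fderiv ℝ ψ p (shA X p)) (fderiv ℝ ψ p (Y p)) =
      mink (sff ψ conn X Y p) (Z - fderiv ℝ ψ p (ZT p))
  /-- The 1-form `β` with `B(X, Z^⊤) = β(X) Z^⊥`. -/
  beta : Pt → Pt → ℝ
  hbeta : ∀ X, ∀ p ∈ U, sff ψ conn X ZT p = beta p (X p) • (Z - fderiv ℝ ψ p (ZT p))
  /-- The lightlike normal field `W'` with `⟨Z^⊥, W'⟩ = 1`, such that
  `(Z^⊤, W, (Z^⊥+W')/√2, (Z^⊥−W')/√2)` is a positively oriented orthonormal frame. -/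
  Wp : Pt → E4
  hWpNormal : ∀ p ∈ U, isNormalV ψ p (Wp p)
  hWpNull : ∀ p ∈ U, mink (Wp p) (Wp p) = 0
  hWpPair : ∀ p ∈ U, mink (Z - fderiv ℝ ψ p (ZT p)) (Wp p) = 1
  hWpOrient : ∀ p ∈ U, 0 < det4 (fderiv ℝ ψ p (ZT p)) (fderiv ℝ ψ p (Wc p))
    ((Real.sqrt 2)⁻¹ • ((Z - fderiv ℝ ψ p (ZT p)) + Wp p))
    ((Real.sqrt 2)⁻¹ • ((Z - fderiv ℝ ψ p (ZT p)) - Wp p))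

namespace CNND

variable (S : CNND)

/-- The normal part `Z^⊥` of `Z` along the surface. -/
def Zperp : Pt → E4 := fun p => S.Z - fderiv ℝ S.ψ p (S.ZT p)

/-- The second fundamental form of the surface. -/
def B : (Pt → Pt) → (Pt → Pt) → Pt → E4 := sff S.ψ S.conn

/-- The function `a = α(W) = ⟨B(W,W), Z^⊥⟩`. -/
def afun : Pt → ℝ := fun p => mink (S.B S.Wc S.Wc p) (S.Zperp p)

/-- The 1-form `α(X) = ⟨B(X,W), Z^⊥⟩`. -/
def alphaF (X : Pt → Pt) : Pt → ℝ := fun p => mink (S.B X S.Wc p) (S.Zperp p)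

/-- The mean curvature vector `H⃗ = (1/2)(B(Z^⊤,Z^⊤) + B(W,W))`. -/
def Hvec : Pt → E4 := fun p => (1 / 2 : ℝ) • (S.B S.ZT S.ZT p + S.B S.Wc S.Wc p)

/-- The Gauss curvature `K = ⟨R(Z^⊤,W)Z^⊤, W⟩`. -/
def Kfun : Pt → ℝ := fun p =>
  mink (fderiv ℝ S.ψ p (curvR S.conn S.ZT S.Wc S.ZT p)) (fderiv ℝ S.ψ p (S.Wc p))

/-- The normal curvature `K_N = ⟨R^⊥(Z^⊤,W)Z^⊥, W'⟩`. -/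
def KNfun : Pt → ℝ := fun p => mink (curvRperp S.nconn S.ZT S.Wc S.Zperp p) (S.Wp p)

end CNND

/-- The wedge `v ∧ w` of two vectors of `ℝ⁴`, as an antisymmetric matrix (bivector). -/
def wedge2 (v w : E4) : Fin 4 → Fin 4 → ℝ := fun i j => v i * w j - v j * w i

/-- The Gauss map `G = Z^⊤ ∧ W : M → Λ²ℝ^{3,1}`. -/
def CNND.Gmap (S : CNND) : Pt → Fin 4 → Fin 4 → ℝ :=
  fun p => wedge2 (fderiv ℝ S.ψ p (S.ZT p)) (fderiv ℝ S.ψ p (S.Wc p))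

/-- The signs of the Minkowski metric. -/
def epsM : Fin 4 → ℝ := fun i => if i = 3 then -1 else 1

/-- The induced (signature `(3,3)`) inner product on bivectors of `ℝ^{3,1}`:
`⟨v∧w, v'∧w'⟩ = ⟨v,v'⟩⟨w,w'⟩ − ⟨v,w'⟩⟨w,v'⟩`. -/
def binner (η η' : Fin 4 → Fin 4 → ℝ) : ℝ :=
  (1 / 2) * ∑ i : Fin 4, ∑ j : Fin 4, epsM i * epsM j * η i j * η' i j

/-- The wedge product `Λ²ℝ^{3,1} × Λ²ℝ^{3,1} → Λ⁴ℝ^{3,1} ≅ ℝ`, normalized so that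
`(v∧w)∧(v'∧w') = det(v,w,v',w')`. -/
def bwedge (η η' : Fin 4 → Fin 4 → ℝ) : ℝ :=
  (1 / 4) * ∑ σ : Equiv.Perm (Fin 4),
    ((Equiv.Perm.sign σ : ℤ) : ℝ) * η (σ 0) (σ 1) * η' (σ 2) (σ 3)

/-- The `ℂ`-bilinear form `H(η,η') = ⟨η,η'⟩ + i η∧η'` on bivectors, where `i = −⋆`. -/
def HformC (η η' : Fin 4 → Fin 4 → ℝ) : ℂ :=
  (binner η η' : ℝ) + (bwedge η η' : ℝ) * Complex.I

/-- The quadratic form `δ(u) = dG(u) ∧ dG(u)` whose zero directions are the asymptotic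
directions. -/
def CNND.deltaQ (S : CNND) (p : Pt) (u : Pt) : ℝ :=
  bwedge (fderiv ℝ S.Gmap p u) (fderiv ℝ S.Gmap p u)

lemma mink_comm (v w : E4) : mink v w = mink w v := by
  simp only [mink]; ring

lemma mink_add_left (u v w : E4) : mink (u + v) w = mink u w + mink v w := by
  simp only [mink, Pi.add_apply]; ring

lemma mink_sub_left (u v w : E4) : mink (u - v) w = mink u w - mink v w := by
  simp only [mink, Pi.sub_apply]; ring

lemma mink_smul_left (c : ℝ) (v w : E4) : mink (c • v) w = c * mink v w := by
  simp only [mink, Pi.smul_apply, smul_eq_mul]; ring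

lemma mink_neg_left (v w : E4) : mink (-v) w = -mink v w := by
  simp only [mink, Pi.neg_apply]; ring

lemma mink_zero_left (w : E4) : mink 0 w = 0 := by
  simp [mink]

lemma mink_add_right (u v w : E4) : mink u (v + w) = mink u v + mink u w := by
  simp only [mink, Pi.add_apply]; ring

lemma mink_smul_right (c : ℝ) (v w : E4) : mink v (c • w) = c * mink v w := by
  simp only [mink, Pi.smul_apply, smul_eq_mul]; ring

/-- Leibniz rule for two fields whose Minkowski product is constant near a point. -/
lemma mink_fderiv_add_eq_zero {f g : Pt → E4} {p : Pt} {c : ℝ}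
    (hf : DifferentiableAt ℝ f p) (hg : DifferentiableAt ℝ g p)
    (h : (fun q => mink (f q) (g q)) =ᶠ[nhds p] fun _ => c) (v : Pt) :
    mink (fderiv ℝ f p v) (g p) + mink (f p) (fderiv ℝ g p v) = 0 := by
  have hfi := fun i => hasFDerivAt_pi'.1 hf.hasFDerivAt i
  have hgi := fun i => hasFDerivAt_pi'.1 hg.hasFDerivAt i
  have hprod := ((((hfi 0).mul (hgi 0)).add ((hfi 1).mul (hgi 1))).add
    ((hfi 2).mul (hgi 2))).sub ((hfi 3).mul (hgi 3))
  have hconst := (hasFDerivAt_const (𝕜 := ℝ) c p).congr_of_eventuallyEq h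
  have huniq := DFunLike.congr_fun (hprod.unique hconst) v
  simp at huniq
  simp only [mink]
  linarith

namespace CNND

variable (S : CNND) {p : Pt}

lemma contDiffOn_vecF {X : Pt → Pt} (hX : ContDiffOn ℝ (⊤ : ℕ∞) X S.U) :
    ContDiffOn ℝ (⊤ : ℕ∞) (vecF S.ψ X) S.U :=
  (S.hψ.fderiv_of_isOpen S.hUopen (by simp)).clm_apply hX

lemma differentiableAt_of_contDiffOn {F : Type*} [NormedAddCommGroup F] [NormedSpace ℝ F]
    {f : Pt → F} (hf : ContDiffOn ℝ (⊤ : ℕ∞) f S.U) (hp : p ∈ S.U) : DifferentiableAt ℝ f p :=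
  (hf.contDiffAt (S.hUopen.mem_nhds hp)).differentiableAt (by simp)

lemma contDiffOn_Zperp : ContDiffOn ℝ (⊤ : ℕ∞) S.Zperp S.U :=
  contDiffOn_const.sub (S.contDiffOn_vecF S.hZTsmooth)

lemma fderiv_Zperp (v : Pt) : fderiv ℝ S.Zperp p v = -fderiv ℝ (vecF S.ψ S.ZT) p v := by
  have h : S.Zperp = fun q => S.Z - vecF S.ψ S.ZT q := rfl
  rw [h, fderiv_const_sub]
  rfl

lemma eq_zero_of_isNormalV (hp : p ∈ S.U) {v : Pt} (h : isNormalV S.ψ p (fderiv ℝ S.ψ p v)) :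
    v = 0 := by
  by_contra hv
  exact (S.hspacelike p hp v hv).ne' (h v)

lemma exists_coord (hp : p ∈ S.U) (v : Pt) : ∃ x y : ℝ, v = x • S.ZT p + y • S.Wc p := by
  have hd := (S.hWorient p hp).ne'
  set d := (S.ZT p).1 * (S.Wc p).2 - (S.ZT p).2 * (S.Wc p).1 with hd'
  refine ⟨(v.1 * (S.Wc p).2 - v.2 * (S.Wc p).1) / d,
    ((S.ZT p).1 * v.2 - (S.ZT p).2 * v.1) / d, ?_⟩
  ext <;> simp <;> field_simp <;> rw [hd'] <;> ring

lemma isNormalV_of_frame (hp : p ∈ S.U) {n : E4} (hT : mink n (vecF S.ψ S.ZT p) = 0)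
    (hW : mink n (vecF S.ψ S.Wc p) = 0) : isNormalV S.ψ p n := by
  intro w
  obtain ⟨x, y, rfl⟩ := S.exists_coord hp w
  simp only [vecF] at hT hW
  simp [mink_add_right, mink_smul_right, hT, hW]

lemma mink_ZT_self (hp : p ∈ S.U) : mink (vecF S.ψ S.ZT p) (vecF S.ψ S.ZT p) = 1 := by
  have h1 := S.hZperpNull p hp
  have h2 := S.hZTtangentpart p hp (S.ZT p)
  have h3 := S.hZunit
  simp only [mink, vecF, Pi.sub_apply] at *
  linarith

lemma mink_Dflat_Wc_Zperp (hp : p ∈ S.U) (X : Pt → Pt) :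
    mink (Dflat X (vecF S.ψ S.Wc) p) (S.Zperp p) = mink (S.B X S.Wc p) (S.Zperp p) := by
  have h := S.hZTtangentpart p hp (S.conn X S.Wc p)
  rw [mink_comm] at h
  simp only [B, sff, mink_sub_left, vecF, Zperp] at *
  linarith

/-- `B(X, Z^⊤)` is orthogonal to `Z^⊥`. -/
lemma mink_B_ZT_Zperp (hp : p ∈ S.U) (X : Pt → Pt) :
    mink (S.B X S.ZT p) (S.Zperp p) = 0 := by
  have h : S.B X S.ZT p = S.beta p (X p) • S.Zperp p := S.hbeta X p hp
  have hnull : mink (S.Zperp p) (S.Zperp p) = 0 := S.hZperpNull p hp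
  rw [h, mink_smul_left, hnull, mul_zero]

lemma mink_Dflat_ZT_Zperp (hp : p ∈ S.U) (X : Pt → Pt) :
    mink (Dflat X (vecF S.ψ S.ZT) p) (S.Zperp p) = 0 := by
  have h := S.hZTtangentpart p hp (S.conn X S.ZT p)
  have hB := S.mink_B_ZT_Zperp hp X
  rw [mink_comm] at h
  simp only [B, sff, mink_sub_left, vecF, Zperp] at *
  linarith

/-- The flat connection is torsion free along the immersion. -/
lemma Dflat_vecF_sub (hp : p ∈ S.U) {X Y : Pt → Pt} (hX : DifferentiableAt ℝ X p)
    (hY : DifferentiableAt ℝ Y p) :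
    Dflat X (vecF S.ψ Y) p - Dflat Y (vecF S.ψ X) p = fderiv ℝ S.ψ p (lieB X Y p) := by
  have hψ := S.hψ.contDiffAt (S.hUopen.mem_nhds hp)
  have hsymm := (hψ.isSymmSndFDerivAt
    (by simpa using WithTop.coe_le_coe.2 (le_top (a := (2 : ℕ∞))))).eq (X p) (Y p)
  have hd : DifferentiableAt ℝ (fderiv ℝ S.ψ) p :=
    S.differentiableAt_of_contDiffOn (S.hψ.fderiv_of_isOpen S.hUopen (by simp)) hp
  have h1 := (hd.hasFDerivAt.clm_apply hY.hasFDerivAt).fderiv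
  have h2 := (hd.hasFDerivAt.clm_apply hX.hasFDerivAt).fderiv
  unfold Dflat vecF lieB
  simp only [h1, h2]
  simp [hsymm]

/-- Flatness of the flat connection. -/
lemma Dflat_commutator (hp : p ∈ S.U) {X Y : Pt → Pt} {V : Pt → E4}
    (hX : DifferentiableAt ℝ X p) (hY : DifferentiableAt ℝ Y p)
    (hV : ContDiffOn ℝ (⊤ : ℕ∞) V S.U) :
    Dflat Y (Dflat X V) p - Dflat X (Dflat Y V) p + Dflat (lieB X Y) V p = 0 := by
  have hVp := hV.contDiffAt (S.hUopen.mem_nhds hp)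
  have hsymm := (hVp.isSymmSndFDerivAt
    (by simpa using WithTop.coe_le_coe.2 (le_top (a := (2 : ℕ∞))))).eq (X p) (Y p)
  have hd : DifferentiableAt ℝ (fderiv ℝ V) p :=
    S.differentiableAt_of_contDiffOn (hV.fderiv_of_isOpen S.hUopen (by simp)) hp
  have h1 := (hd.hasFDerivAt.clm_apply hY.hasFDerivAt).fderiv
  have h2 := (hd.hasFDerivAt.clm_apply hX.hasFDerivAt).fderiv
  unfold Dflat lieB
  simp only [h1, h2]
  simp [hsymm]

lemma mink_fderiv_ZT_Wc (hp : p ∈ S.U) (v : Pt) :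
    mink (fderiv ℝ (vecF S.ψ S.ZT) p v) (vecF S.ψ S.Wc p) =
      mink (fderiv ℝ (vecF S.ψ S.Wc) p v) (S.Zperp p) := by
  have h := mink_fderiv_add_eq_zero (c := 0)
    (S.differentiableAt_of_contDiffOn S.contDiffOn_Zperp hp)
    (S.differentiableAt_of_contDiffOn (S.contDiffOn_vecF S.hWsmooth) hp)
    (Filter.eventually_of_mem (S.hUopen.mem_nhds hp)
      fun q hq => S.hZTtangentpart q hq (S.Wc q)) v
  rw [fderiv_Zperp, mink_neg_left, mink_comm (S.Zperp p)] at h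
  linarith

/-- On a minimal surface `∇̄_X Z^⊤` is normal for every tangent `X`. -/
lemma isNormalV_fderiv_ZT (hmin : ∀ p ∈ S.U, S.Hvec p = 0) (hp : p ∈ S.U) (v : Pt) :
    isNormalV S.ψ p (fderiv ℝ (vecF S.ψ S.ZT) p v) := by
  have hdT := S.differentiableAt_of_contDiffOn (S.contDiffOn_vecF S.hZTsmooth) hp
  refine S.isNormalV_of_frame hp ?_ ?_
  · have h := mink_fderiv_add_eq_zero hdT hdT
      (Filter.eventually_of_mem (S.hUopen.mem_nhds hp) fun q hq => S.mink_ZT_self hq) v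
    rw [mink_comm (vecF S.ψ S.ZT p)] at h
    linarith
  · have hTW : mink (Dflat S.ZT (vecF S.ψ S.Wc) p) (S.Zperp p) = 0 := by
      have hsub := S.Dflat_vecF_sub hp (S.differentiableAt_of_contDiffOn S.hZTsmooth hp)
        (S.differentiableAt_of_contDiffOn S.hWsmooth hp)
      have hn := S.hZTtangentpart p hp (lieB S.ZT S.Wc p)
      rw [← hsub, mink_comm, mink_sub_left] at hn
      have hWT := S.mink_Dflat_ZT_Zperp hp S.Wc
      simp only [Zperp] at *
      linarith
    have hWW : mink (Dflat S.Wc (vecF S.ψ S.Wc) p) (S.Zperp p) = 0 := by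
      rw [mink_Dflat_Wc_Zperp S hp]
      have hH := congrArg (mink · (S.Zperp p)) (hmin p hp)
      simp only [Hvec, mink_smul_left, mink_add_left, S.mink_B_ZT_Zperp hp, mink_zero_left] at hH
      linarith
    rw [mink_fderiv_ZT_Wc S hp]
    obtain ⟨x, y, rfl⟩ := S.exists_coord hp v
    simp only [Dflat] at hTW hWW
    simp [mink_add_left, mink_smul_left, hTW, hWW]

lemma conn_eq_zero (hp : p ∈ S.U) {X Y : Pt → Pt} (hY : DifferentiableAt ℝ (vecF S.ψ Y) p)
    (h : isNormalV S.ψ p (Dflat X (vecF S.ψ Y) p)) : S.conn X Y p = 0 := by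
  refine S.eq_zero_of_isNormalV hp fun w => ?_
  have h1 := S.hconn X Y p hp hY w
  have h2 := h w
  simp only [sff, mink_sub_left] at h1
  simp only [vecF] at h1 h2
  linarith

lemma conn_conn_eq_zero (hp : p ∈ S.U) {X Y V : Pt → Pt} (h : ∀ q ∈ S.U, S.conn Y V q = 0) :
    S.conn X (S.conn Y V) p = 0 := by
  have hev : vecF S.ψ (S.conn Y V) =ᶠ[nhds p] fun _ => 0 :=
    Filter.eventually_of_mem (S.hUopen.mem_nhds hp) fun q hq => by simp [vecF, h q hq]
  refine S.conn_eq_zero hp ((differentiableAt_const _).congr_of_eventuallyEq hev) fun w => ?_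
  simp [Dflat, hev.fderiv_eq, mink_zero_left]

lemma mink_nconn (hp : p ∈ S.U) {X : Pt → Pt} {ν : Pt → E4} {n : E4}
    (hν : ∀ q ∈ S.U, isNormalV S.ψ q (ν q)) (hd : DifferentiableAt ℝ ν p)
    (hn : isNormalV S.ψ p n) : mink (S.nconn X ν p) n = mink (Dflat X ν p) n := by
  obtain ⟨w, hw⟩ := (S.hnconn X ν p hp hν hd).2
  have h := hn w
  rw [hw, mink_comm, mink_sub_left] at h
  linarith

lemma nconn_eq_Dflat (hp : p ∈ S.U) {X : Pt → Pt} {ν : Pt → E4}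
    (hν : ∀ q ∈ S.U, isNormalV S.ψ q (ν q)) (hd : DifferentiableAt ℝ ν p)
    (h : isNormalV S.ψ p (Dflat X ν p)) : S.nconn X ν p = Dflat X ν p := by
  obtain ⟨hn, w, hw⟩ := S.hnconn X ν p hp hν hd
  have hw0 : w = 0 := S.eq_zero_of_isNormalV hp fun u => by
    rw [hw, mink_sub_left, h u, hn u, sub_zero]
  rw [hw0, map_zero] at hw
  exact (sub_eq_zero.1 hw.symm).symm

end CNND

/-- If `M` is minimal, i.e. `H⃗ = 0`, then `M` is flat and has flat normal
bundle, i.e. `K = 0` and `K_N = 0`. -/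
theorem cnnd_minimal_implies_flat (S : CNND) (hmin : ∀ p ∈ S.U, S.Hvec p = 0) :
    ∀ p ∈ S.U, S.Kfun p = 0 ∧ S.KNfun p = 0 := by
  intro p hp
  have hnormal := fun q (hq : q ∈ S.U) => S.isNormalV_fderiv_ZT hmin hq
  have hdT := fun q (hq : q ∈ S.U) =>
    S.differentiableAt_of_contDiffOn (S.contDiffOn_vecF S.hZTsmooth) hq
  constructor
  · have hconn : ∀ X, ∀ q ∈ S.U, S.conn X S.ZT q = 0 := fun X q hq =>
      S.conn_eq_zero hq (hdT q hq) (hnormal q hq _)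
    simp only [CNND.Kfun, curvR, hconn _ p hp, S.conn_conn_eq_zero hp (hconn _)]
    simp [mink_zero_left]
  · have hN : ∀ q ∈ S.U, isNormalV S.ψ q (S.Zperp q) := S.hZTtangentpart
    have hdN := fun q (hq : q ∈ S.U) => S.differentiableAt_of_contDiffOn S.contDiffOn_Zperp hq
    have hnconn : ∀ X, ∀ q ∈ S.U, S.nconn X S.Zperp q = Dflat X S.Zperp q := fun X q hq => by
      refine S.nconn_eq_Dflat hq hN (hdN q hq) fun w => ?_
      rw [Dflat, S.fderiv_Zperp, mink_neg_left, hnormal q hq, neg_zero]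
    have hsecond : ∀ X Y, ContDiffOn ℝ (⊤ : ℕ∞) Y S.U →
        mink (S.nconn X (S.nconn Y S.Zperp) p) (S.Wp p) =
          mink (Dflat X (Dflat Y S.Zperp) p) (S.Wp p) := fun X Y hY => by
      rw [S.mink_nconn hp (fun q hq => (S.hnconn Y _ q hq hN (hdN q hq)).1)
        (S.differentiableAt_of_contDiffOn (S.hnconnSmooth Y _ hY hN S.contDiffOn_Zperp) hp)
        (S.hWpNormal p hp)]
      have hev : S.nconn Y S.Zperp =ᶠ[nhds p] Dflat Y S.Zperp :=
        Filter.eventually_of_mem (S.hUopen.mem_nhds hp) (hnconn Y)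
      rw [Dflat, hev.fderiv_eq, Dflat]
    rw [CNND.KNfun, curvRperp, mink_add_left, mink_sub_left, hsecond _ _ S.hZTsmooth,
      hsecond _ _ S.hWsmooth, hnconn _ p hp, ← mink_sub_left, ← mink_add_left,
      S.Dflat_commutator hp (S.differentiableAt_of_contDiffOn S.hZTsmooth hp)
        (S.differentiableAt_of_contDiffOn S.hWsmooth hp) S.contDiffOn_Zperp, mink_zero_left]

end
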